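/- arXiv:2601.22850 — 11 statements merged into one kernel-verified Lean document; each statement's English description precedes it below -/
import Mathlib

section
/- Let (a_k)_{k∈ℕ} be a sequence of positive real numbers that is monotonically decreasing (a_{k+1} ≤ a_k for all k), and let q ∈ (0,1). Then for all natural numbers k and l, the partial sum satisfies Σ_{j=k}^{k+l} (a_j − a_{j+1})/a_j^q ≤ (1/(1−q)) · (a_k^{1−q} − a_{k+l+1}^{1−q}). -/
/-- The tangent-line inequality for the concave function `t ↦ t ^ (1 - q)`. -/
theorem sub_div_rpow_le_rpow_sub_rpow {x y q : ℝ} (hx : 0 < x) (hy : 0 ≤ y)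
    (hq0 : 0 ≤ q) (hq1 : q < 1) :
    (x - y) / x ^ q ≤ (1 / (1 - q)) * (x ^ (1 - q) - y ^ (1 - q)) := by
  have hxq : 0 < x ^ q := Real.rpow_pos_of_pos hx q
  have hq : 0 < 1 - q := sub_pos.mpr hq1
  have amgm := Real.geom_mean_le_arith_mean2_weighted hq.le hq0 hy hx.le (sub_add_cancel 1 q)
  have hmul : x ^ (1 - q) * x ^ q = x := by
    rw [← Real.rpow_add hx, sub_add_cancel, Real.rpow_one]
  rw [one_div_mul_eq_div, div_le_div_iff₀ hxq hq, sub_mul (x ^ (1 - q)), hmul]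
  linarith

/-- Lemma 4 (Lemma `propositionAbsil2005`): for a monotonically decreasing sequence of
positive reals `a` and `q ∈ (0,1)`, the partial sums
`Σ_{j=k}^{k+l} (a j − a (j+1)) / (a j)^q` are bounded by
`(1/(1−q)) * ((a k)^(1−q) − (a (k+l+1))^(1−q))`. -/
theorem stmt_0 (a : ℕ → ℝ) (ha_pos : ∀ k, 0 < a k)
    (ha_dec : ∀ k, a (k + 1) ≤ a k) (q : ℝ) (hq0 : 0 < q) (hq1 : q < 1) :
    ∀ k l : ℕ,
      ∑ j ∈ Finset.Icc k (k + l), (a j - a (j + 1)) / (a j) ^ q ≤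
        (1 / (1 - q)) * ((a k) ^ (1 - q) - (a (k + l + 1)) ^ (1 - q)) := by
  intro k l
  induction l with
  | zero =>
    simpa using sub_div_rpow_le_rpow_sub_rpow (ha_pos k) (ha_pos (k + 1)).le hq0.le hq1
  | succ l ih =>
    rw [← add_assoc, Finset.sum_Icc_succ_top (by omega)]
    have step := sub_div_rpow_le_rpow_sub_rpow (ha_pos (k + l + 1)) (ha_pos (k + l + 1 + 1)).le
      hq0.le hq1
    linarith
end

section
/- Let L : ℝ^n × ℝ^m → ℝ be bounded from below, let (x_k) ⊂ ℝ^n, (y_k) ⊂ ℝ^m, and let (λ_k), (μ_k) be sequences of positive reals with λ_k, μ_k ∈ (r₋, r₊) for fixed 0 < r₋ < r₊. Assume that for every k: L(x_{k+1}, y_k) + ‖x_{k+1} − x_k‖²/(2λ_k) ≤ L(u, y_k) + ‖u − x_k‖²/(2λ_k) for all u ∈ ℝ^n, and L(x_{k+1}, y_{k+1}) + ‖y_{k+1} − y_k‖²/(2μ_k) ≤ L(x_{k+1}, v) + ‖v − y_k‖²/(2μ_k) for all v ∈ ℝ^m. Then the series Σ_{k≥1} (‖x_k − x_{k−1}‖²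 + ‖y_k − y_{k−1}‖²) converges, and consequently ‖x_k − x_{k−1}‖ + ‖y_k − y_{k−1}‖ → 0 as k → ∞. -/
/-- A nonnegative sequence dominated by a multiple of the decrements of a sequence bounded below
is summable. -/
theorem summable_of_le_mul_decrement {a f : ℕ → ℝ} {B c : ℝ} (ha : ∀ k, 0 ≤ a k) (hc : 0 ≤ c)
    (hf : ∀ k, B ≤ f k) (h : ∀ k, a k ≤ c * (f k - f (k + 1))) : Summable a := by
  refine summable_of_sum_range_le (c := c * (f 0 - B)) ha fun N => ?_
  calc ∑ k ∈ Finset.range N, a k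
      ≤ ∑ k ∈ Finset.range N, c * (f k - f (k + 1)) := Finset.sum_le_sum fun k _ => h k
    _ = c * (f 0 - f N) := by rw [← Finset.mul_sum, Finset.sum_range_sub']
    _ ≤ c * (f 0 - B) := by gcongr; exact hf N

/-- If `a k ^ 2 + b k ^ 2` tends to `0`, so does `a k + b k`, for nonnegative `a` and `b`. -/
theorem tendsto_add_zero_of_tendsto_sq_add_sq {a b : ℕ → ℝ} (ha : ∀ k, 0 ≤ a k)
    (hb : ∀ k, 0 ≤ b k)
    (h : Filter.Tendsto (fun k => a k ^ 2 + b k ^ 2) Filter.atTop (nhds 0)) :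
    Filter.Tendsto (fun k => a k + b k) Filter.atTop (nhds 0) := by
  have hsqrt : Filter.Tendsto (fun k => √(2 * (a k ^ 2 + b k ^ 2))) Filter.atTop (nhds 0) := by
    simpa using (h.const_mul 2).sqrt
  refine squeeze_zero (fun k => add_nonneg (ha k) (hb k)) (fun k => ?_) hsqrt
  exact Real.le_sqrt_of_sq_le add_sq_le

/-- The proximal penalty with step size `t < R` controls `d ^ 2` up to the factor `2 * R`. -/
theorem sq_le_mul_div_of_mem_Ioo {r R t d : ℝ} (hr : 0 < r) (ht : t ∈ Set.Ioo r R) :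
    d ^ 2 ≤ 2 * R * (d ^ 2 / (2 * t)) := by
  have ht0 : 0 < t := hr.trans ht.1
  calc d ^ 2 = 2 * t * (d ^ 2 / (2 * t)) := by field_simp
    _ ≤ 2 * R * (d ^ 2 / (2 * t)) := by gcongr; exact ht.2.le

/-- Lemma 1(ii): for the alternating minimization algorithm with stepsizes in `(r₋, r₊)`
and `L` bounded below, the series `Σ_{k≥1} (‖x_k − x_{k−1}‖² + ‖y_k − y_{k−1}‖²)`
converges, and hence `‖x_k − x_{k−1}‖ + ‖y_k − y_{k−1}‖ → 0`. -/
theorem stmt_2 (n m : ℕ)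
    (L : EuclideanSpace ℝ (Fin n) × EuclideanSpace ℝ (Fin m) → ℝ)
    (hbdd : ∃ B : ℝ, ∀ p, B ≤ L p)
    (x : ℕ → EuclideanSpace ℝ (Fin n)) (y : ℕ → EuclideanSpace ℝ (Fin m))
    (lam mu : ℕ → ℝ) (rminus rplus : ℝ)
    (hr : 0 < rminus) (hrr : rminus < rplus)
    (hlam : ∀ k, lam k ∈ Set.Ioo rminus rplus)
    (hmu : ∀ k, mu k ∈ Set.Ioo rminus rplus)
    (hx : ∀ k, ∀ u : EuclideanSpace ℝ (Fin n),
      L (x (k + 1), y k) + ‖x (k + 1) - x k‖ ^ 2 / (2 * lam k) ≤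
        L (u, y k) + ‖u - x k‖ ^ 2 / (2 * lam k))
    (hy : ∀ k, ∀ v : EuclideanSpace ℝ (Fin m),
      L (x (k + 1), y (k + 1)) + ‖y (k + 1) - y k‖ ^ 2 / (2 * mu k) ≤
        L (x (k + 1), v) + ‖v - y k‖ ^ 2 / (2 * mu k)) :
    Summable (fun k : ℕ => ‖x (k + 1) - x k‖ ^ 2 + ‖y (k + 1) - y k‖ ^ 2) ∧
      Filter.Tendsto (fun k : ℕ => ‖x (k + 1) - x k‖ + ‖y (k + 1) - y k‖)
        Filter.atTop (nhds 0) := by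
  obtain ⟨B, hB⟩ := hbdd
  have hs : Summable (fun k : ℕ => ‖x (k + 1) - x k‖ ^ 2 + ‖y (k + 1) - y k‖ ^ 2) := by
    refine summable_of_le_mul_decrement (f := fun k => L (x k, y k)) (c := 2 * rplus)
      (fun k => by positivity) (by linarith) (fun k => hB _) fun k => ?_
    have hxk := hx k (x k)
    have hyk := hy k (y k)
    simp only [sub_self, norm_zero, ne_eq, OfNat.ofNat_ne_zero, not_false_eq_true, zero_pow,
      zero_div, add_zero] at hxk hyk
    calc ‖x (k + 1) - x k‖ ^ 2 + ‖y (k + 1) - y k‖ ^ 2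
        ≤ 2 * rplus * (‖x (k + 1) - x k‖ ^ 2 / (2 * lam k))
          + 2 * rplus * (‖y (k + 1) - y k‖ ^ 2 / (2 * mu k)) :=
          add_le_add (sq_le_mul_div_of_mem_Ioo hr (hlam k)) (sq_le_mul_div_of_mem_Ioo hr (hmu k))
      _ = 2 * rplus * (‖x (k + 1) - x k‖ ^ 2 / (2 * lam k)
          + ‖y (k + 1) - y k‖ ^ 2 / (2 * mu k)) := by ring
      _ ≤ 2 * rplus * (L (x k, y k) - L (x (k + 1), y (k + 1))) :=
          mul_le_mul_of_nonneg_left (by linarith) (by linarith)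
  exact ⟨hs, tendsto_add_zero_of_tendsto_sq_add_sq (fun _ => norm_nonneg _)
    (fun _ => norm_nonneg _) hs.tendsto_atTop_zero⟩
end

section
/- Let Q : ℝ^n × ℝ^m → ℝ be continuously differentiable with gradient ∇Q Lipschitz continuous on every bounded subset of ℝ^n × ℝ^m. Let (x_k) ⊂ ℝ^n, (y_k) ⊂ ℝ^m satisfy ‖x_k − x_{k−1}‖ → 0 and ‖y_k − y_{k−1}‖ → 0, and let λ_k, μ_k ∈ (r₋, r₊) with 0 < r₋ < r₊. For every k ≥ 1 define x*_k := ∇_x Q(x_k, y_k) − ∇_x Q(x_k, y_{k−1}) − (1/λ_{k−1})(x_k − x_{k−1}) and y*_k := −(1/μ_{k−1})(y_k − y_{k−1}). Then for any subsequence (x_{k_j}, y_{k_j}) that is bounded, one has (x*_{k_j}, y*_{k_j}) → (0, 0) as j → ∞. -/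
open Filter

/-- The partial gradient in the first variable is the first component of the full gradient. -/
theorem gradient_comp_toLp_left {E F : Type*}
    [NormedAddCommGroup E] [InnerProductSpace ℝ E] [CompleteSpace E]
    [NormedAddCommGroup F] [InnerProductSpace ℝ F] [CompleteSpace F]
    {Q : WithLp 2 (E × F) → ℝ} {u : E} {v : F}
    (hQ : DifferentiableAt ℝ Q (WithLp.toLp 2 (u, v))) :
    gradient (fun w => Q (WithLp.toLp 2 (w, v))) u =
      (gradient Q (WithLp.toLp 2 (u, v))).fst := by
  apply HasGradientAt.gradient
  rw [hasGradientAt_iff_hasFDerivAt]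
  have h := hQ.hasGradientAt.hasFDerivAt
  generalize gradient Q (WithLp.toLp 2 (u, v)) = g at h ⊢
  have hι : HasFDerivAt (fun w : E => WithLp.toLp 2 (w, v))
      ((WithLp.prodContinuousLinearEquiv 2 ℝ E F).symm.toContinuousLinearMap.comp
        (ContinuousLinearMap.inl ℝ E F)) u :=
    (WithLp.prodContinuousLinearEquiv 2 ℝ E F).symm.hasFDerivAt.comp u
      (hasFDerivAt_prodMk_left u v)
  refine (h.comp u hι).congr_fderiv ?_
  ext w
  simp [WithLp.prod_inner_apply]

/-- If `∇Q` is `K`-Lipschitz on `s`, then the partial gradient in the first variable is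
`K`-Lipschitz in the second variable along points of `s`. -/
theorem norm_gradient_toLp_left_sub_le {E F : Type*}
    [NormedAddCommGroup E] [InnerProductSpace ℝ E] [CompleteSpace E]
    [NormedAddCommGroup F] [InnerProductSpace ℝ F] [CompleteSpace F]
    {Q : WithLp 2 (E × F) → ℝ} (hQ : Differentiable ℝ Q) {K : NNReal}
    {s : Set (WithLp 2 (E × F))} (hK : LipschitzOnWith K (gradient Q) s) {u : E} {v v' : F}
    (hv : WithLp.toLp 2 (u, v) ∈ s) (hv' : WithLp.toLp 2 (u, v') ∈ s) :
    ‖gradient (fun w => Q (WithLp.toLp 2 (w, v))) u -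
      gradient (fun w => Q (WithLp.toLp 2 (w, v'))) u‖ ≤ K * ‖v - v'‖ := by
  rw [gradient_comp_toLp_left (hQ _), gradient_comp_toLp_left (hQ _), ← WithLp.sub_fst]
  calc _ ≤ ‖gradient Q (WithLp.toLp 2 (u, v)) - gradient Q (WithLp.toLp 2 (u, v'))‖ :=
        WithLp.norm_fst_le _ _
    _ ≤ K * ‖WithLp.toLp 2 (u, v) - WithLp.toLp 2 (u, v')‖ := hK.norm_sub_le hv hv'
    _ = K * ‖v - v'‖ := by
      rw [← WithLp.toLp_sub, Prod.mk_sub_mk, sub_self, WithLp.norm_toLp_snd]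

/-- Scaling a null sequence by reciprocals of scalars bounded below by `r > 0` keeps it null. -/
theorem tendsto_one_div_smul_zero {E : Type*} [NormedAddCommGroup E] [NormedSpace ℝ E]
    {c : ℕ → ℝ} {r : ℝ} (hr : 0 < r) (hc : ∀ k, r < c k) {d : ℕ → E}
    (hd : Tendsto (fun k => ‖d k‖) atTop (nhds 0)) :
    Tendsto (fun k => (1 / c k) • d k) atTop (nhds 0) := by
  refine squeeze_zero_norm (fun k => ?_) (by simpa using hd.const_mul r⁻¹)
  have hck := hr.trans (hc k)
  rw [norm_smul, Real.norm_of_nonneg (by positivity)]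
  rw [one_div]
  gcongr
  exact (hc k).le

/-- Lemma 1(iii): for the alternating minimization algorithm, along any bounded
subsequence the subgradient-type vectors
`x*_k = ∇_x Q(x_k, y_k) − ∇_x Q(x_k, y_{k−1}) − (1/λ_{k−1})(x_k − x_{k−1})`,
`y*_k = −(1/μ_{k−1})(y_k − y_{k−1})` tend to `(0, 0)`.
Here the product `ℝ^n × ℝ^m` carries the Euclidean (`L²`) norm, encoded via `WithLp 2`. -/
theorem stmt_3 (n m : ℕ)
    (Q : WithLp 2 (EuclideanSpace ℝ (Fin n) × EuclideanSpace ℝ (Fin m)) → ℝ)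
    (hQ : ContDiff ℝ 1 Q)
    (hLip : ∀ s : Set (WithLp 2 (EuclideanSpace ℝ (Fin n) × EuclideanSpace ℝ (Fin m))),
      Bornology.IsBounded s → ∃ K : NNReal, LipschitzOnWith K (gradient Q) s)
    (x : ℕ → EuclideanSpace ℝ (Fin n)) (y : ℕ → EuclideanSpace ℝ (Fin m))
    (hxconv : Tendsto (fun k => ‖x (k + 1) - x k‖) atTop (nhds 0))
    (hyconv : Tendsto (fun k => ‖y (k + 1) - y k‖) atTop (nhds 0))
    (lam mu : ℕ → ℝ) (rminus rplus : ℝ) (hr : 0 < rminus) (hrr : rminus < rplus)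
    (hlam : ∀ k, lam k ∈ Set.Ioo rminus rplus)
    (hmu : ∀ k, mu k ∈ Set.Ioo rminus rplus)
    (xstar : ℕ → EuclideanSpace ℝ (Fin n)) (ystar : ℕ → EuclideanSpace ℝ (Fin m))
    (hxstar : ∀ k : ℕ, xstar (k + 1) =
      gradient (fun u => Q ((WithLp.equiv 2
          (EuclideanSpace ℝ (Fin n) × EuclideanSpace ℝ (Fin m))).symm
            (u, y (k + 1)))) (x (k + 1))
        - gradient (fun u => Q ((WithLp.equiv 2
          (EuclideanSpace ℝ (Fin n) × EuclideanSpace ℝ (Fin m))).symm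
            (u, y k))) (x (k + 1))
        - (1 / lam k) • (x (k + 1) - x k))
    (hystar : ∀ k : ℕ, ystar (k + 1) = -((1 / mu k) • (y (k + 1) - y k)))
    (φ : ℕ → ℕ) (hφ : StrictMono φ) (hφ1 : ∀ j, 1 ≤ φ j)
    (hbdd : ∃ R : ℝ, ∀ j, ‖x (φ j)‖ + ‖y (φ j)‖ ≤ R) :
    Tendsto (fun j => (xstar (φ j), ystar (φ j))) atTop
      (nhds ((0, 0) : EuclideanSpace ℝ (Fin n) × EuclideanSpace ℝ (Fin m))) := by
  obtain ⟨R, hR⟩ := hbdd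
  obtain ⟨C, hC⟩ := hyconv.bddAbove_range
  obtain ⟨K, hK⟩ := hLip _ (Metric.isBounded_closedBall (x := 0) (r := R + C))
  have hmem : ∀ u v, ‖u‖ + ‖v‖ ≤ R + C →
      WithLp.toLp 2 (u, v) ∈ Metric.closedBall
        (0 : WithLp 2 (EuclideanSpace ℝ (Fin n) × EuclideanSpace ℝ (Fin m))) (R + C) := by
    intro u v h
    rw [mem_closedBall_zero_iff]
    refine le_trans ?_ h
    have hsplit : WithLp.toLp 2 (u, v) = WithLp.toLp 2 (u, 0) + WithLp.toLp 2 (0, v) := by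
      rw [← WithLp.toLp_add, Prod.mk_add_mk, add_zero, zero_add]
    rw [hsplit]
    refine (norm_add_le _ _).trans_eq ?_
    rw [WithLp.norm_toLp_fst, WithLp.norm_toLp_snd]
  obtain ⟨ψ, rfl⟩ : ∃ ψ : ℕ → ℕ, φ = fun j => ψ j + 1 :=
    ⟨fun j => φ j - 1, funext fun j => (Nat.sub_add_cancel (hφ1 j)).symm⟩
  have hψ : Tendsto ψ atTop atTop :=
    StrictMono.tendsto_atTop fun _ _ hab => Nat.lt_of_add_lt_add_right (hφ hab)
  have hbound : ∀ j,
      ‖gradient (fun u => Q (WithLp.toLp 2 (u, y (ψ j + 1)))) (x (ψ j + 1))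
        - gradient (fun u => Q (WithLp.toLp 2 (u, y (ψ j)))) (x (ψ j + 1))‖
        ≤ K * ‖y (ψ j + 1) - y (ψ j)‖ := by
    intro j
    have hRj := hR j
    have hCj : ‖y (ψ j + 1) - y (ψ j)‖ ≤ C := hC ⟨ψ j, rfl⟩
    have hyj := norm_le_norm_add_norm_sub (y (ψ j + 1)) (y (ψ j))
    refine norm_gradient_toLp_left_sub_le (hQ.differentiable one_ne_zero) hK
      (hmem _ _ ?_) (hmem _ _ ?_)
    · linarith [norm_nonneg (y (ψ j + 1) - y (ψ j))]
    · linarith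
  have hgrad := squeeze_zero_norm hbound
    (by simpa using (hyconv.comp hψ).const_mul (K : ℝ))
  have hx := (tendsto_one_div_smul_zero hr (fun k => (hlam k).1) hxconv).comp hψ
  have hy := (tendsto_one_div_smul_zero hr (fun k => (hmu k).1) hyconv).comp hψ
  refine Tendsto.prodMk_nhds ?_ ?_
  · simp only [hxstar]
    simpa using hgrad.sub hx
  · simp only [hystar]
    simpa using hy.neg
end

section
/- Let (Ψ_k) be a sequence of strictly positive real numbers with Ψ_k → 0, let q ∈ (0, 1/2), and let C₀ > 0. Assume that for every k ≥ 1: Ψ_{k−1} − Ψ_k ≥ C₀ · Ψ_k^{2q}. Then Ψ_k / Ψ_{k−1} → 0 as k → ∞; that is, (Ψ_k) converges to 0 superlinearly. -/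
/-- Superlinear convergence of the values in the lower exponent PLK case `q ∈ (0, 1/2)`:
if `Ψ_{k−1} − Ψ_k ≥ C₀ Ψ_k^{2q}` with `Ψ_k > 0` and `Ψ_k → 0`, then `Ψ_k/Ψ_{k−1} → 0`. -/
theorem stmt_6 (Ψ : ℕ → ℝ) (hΨ : ∀ k, 0 < Ψ k)
    (hlim : Filter.Tendsto Ψ Filter.atTop (nhds 0))
    (q : ℝ) (hq0 : 0 < q) (hq1 : q < 1 / 2)
    (C₀ : ℝ) (hC₀ : 0 < C₀)
    (hrec : ∀ k : ℕ, 1 ≤ k → Ψ (k - 1) - Ψ k ≥ C₀ * (Ψ k) ^ (2 * q)) :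
    Filter.Tendsto (fun k : ℕ => Ψ (k + 1) / Ψ k) Filter.atTop (nhds 0) := by
  have hexp : 0 < 1 - 2 * q := by linarith
  have hbound : Filter.Tendsto (fun k : ℕ => Ψ (k + 1) ^ (1 - 2 * q) / C₀)
      Filter.atTop (nhds 0) := by
    have h := ((hlim.comp (Filter.tendsto_add_atTop_nat 1)).rpow_const
      (p := 1 - 2 * q) (Or.inr hexp.le)).div_const C₀
    simpa [Real.zero_rpow hexp.ne'] using h
  refine squeeze_zero (fun k => (div_pos (hΨ (k + 1)) (hΨ k)).le) (fun k => ?_) hbound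
  have hstep : C₀ * Ψ (k + 1) ^ (2 * q) ≤ Ψ k := by
    have h := hrec (k + 1) (Nat.le_add_left 1 k)
    rw [Nat.add_sub_cancel] at h
    linarith [hΨ (k + 1)]
  have hsplit : Ψ (k + 1) ^ (1 - 2 * q) * Ψ (k + 1) ^ (2 * q) = Ψ (k + 1) := by
    rw [← Real.rpow_add (hΨ (k + 1)), sub_add_cancel, Real.rpow_one]
  rw [div_le_div_iff₀ (hΨ k) hC₀]
  calc Ψ (k + 1) * C₀
      = Ψ (k + 1) ^ (1 - 2 * q) * (C₀ * Ψ (k + 1) ^ (2 * q)) := by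
        rw [mul_left_comm, hsplit, mul_comm]
    _ ≤ Ψ (k + 1) ^ (1 - 2 * q) * Ψ k :=
        mul_le_mul_of_nonneg_left hstep (Real.rpow_nonneg (hΨ (k + 1)).le _)
end

section
/- Let (Ψ_k) be a nonincreasing sequence of nonnegative real numbers, let q ∈ (1/2, 1), and let C₀ > 0. Assume that for every k ≥ 1 with Ψ_k > 0: Ψ_{k−1} − Ψ_k ≥ C₀ · Ψ_k^{2q}. Then there exists γ > 0 such that Ψ_k ≤ γ · k^{−1/(2q−1)} for all k ≥ 1. -/
/-- One step of the recursion `b + C * b ^ (1 + p) ≤ a`, expressed through the `p`-th powers. -/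
theorem rpow_mul_one_add_le_of_add_mul_rpow_le {a b C U p : ℝ} (hb : 0 < b) (hC : 0 < C)
    (hp0 : 0 < p) (hp1 : p ≤ 1) (hU : b ^ p ≤ U) (h : b + C * b ^ (1 + p) ≤ a) :
    b ^ p * (1 + p * C / (1 + C * U) * a ^ p) ≤ a ^ p := by
  have hv : 0 < b ^ p := Real.rpow_pos_of_pos hb p
  have hx : 0 < 1 + C * b ^ p := by positivity
  have hxU : 0 < 1 + C * U := by nlinarith
  have hba : b * (1 + C * b ^ p) ≤ a := by
    rw [Real.rpow_add hb, Real.rpow_one] at h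
    linarith
  have ha : 0 < a := (mul_pos hb hx).trans_le hba
  have hw : 0 < a ^ p := Real.rpow_pos_of_pos ha p
  set s : ℝ := -(C * b ^ p / (1 + C * b ^ p)) with hs
  have hs1 : 1 + s = 1 / (1 + C * b ^ p) := by
    rw [hs]
    field_simp
    ring
  have hs0 : 0 < 1 + s := by
    rw [hs1]
    positivity
  have hbs : b ≤ a * (1 + s) := by
    rw [hs1, mul_one_div, le_div_iff₀ hx]
    exact hba
  have hpow : b ^ p ≤ a ^ p * (1 + p * s) := calc
    b ^ p ≤ (a * (1 + s)) ^ p := Real.rpow_le_rpow hb.le hbs hp0.le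
    _ = a ^ p * (1 + s) ^ p := Real.mul_rpow ha.le hs0.le
    _ ≤ a ^ p * (1 + p * s) := by
      gcongr
      exact rpow_one_add_le_one_add_mul_self (by linarith) hp0.le hp1
  have hps : p * C / (1 + C * U) * b ^ p ≤ -(p * s) := calc
    p * C / (1 + C * U) * b ^ p ≤ p * C / (1 + C * b ^ p) * b ^ p := by gcongr
    _ = -(p * s) := by
      rw [hs]
      ring
  nlinarith [mul_le_mul_of_nonneg_left hps hw.le]


/-- Sublinear convergence of the values in the PLK exponent case `q ∈ (1/2, 1)`:
if `Ψ_{k−1} − Ψ_k ≥ C₀ Ψ_k^{2q}` whenever `Ψ_k > 0`, then `Ψ_k ≤ γ k^{−1/(2q−1)}`. -/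
theorem stmt_8 (Ψ : ℕ → ℝ) (hΨ : ∀ k, 0 ≤ Ψ k)
    (hdec : ∀ k, Ψ (k + 1) ≤ Ψ k)
    (q : ℝ) (hq0 : 1 / 2 < q) (hq1 : q < 1)
    (C₀ : ℝ) (hC₀ : 0 < C₀)
    (hrec : ∀ k : ℕ, 1 ≤ k → 0 < Ψ k → Ψ (k - 1) - Ψ k ≥ C₀ * (Ψ k) ^ (2 * q)) :
    ∃ γ : ℝ, 0 < γ ∧ ∀ k : ℕ, 1 ≤ k → Ψ k ≤ γ * (k : ℝ) ^ (-(1 / (2 * q - 1))) := by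
  obtain ⟨p, hp⟩ : ∃ p, p = 2 * q - 1 := ⟨_, rfl⟩
  have hp0 : 0 < p := by linarith
  have hp1 : p ≤ 1 := by linarith
  have h2q : 2 * q = 1 + p := by linarith
  have hanti : Antitone Ψ := antitone_nat_of_succ_le hdec
  set c : ℝ := p * C₀ / (1 + C₀ * Ψ 0 ^ p) with hc
  have hU : 0 ≤ Ψ 0 ^ p := Real.rpow_nonneg (hΨ 0) p
  have hc0 : 0 < c := by positivity
  have key : ∀ k : ℕ, Ψ k ^ p * (c * k) ≤ 1 := by
    intro k
    induction k with
    | zero => simp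
    | succ k ih =>
      rcases (hΨ (k + 1)).eq_or_lt with h0 | hpos
      · rw [← h0, Real.zero_rpow hp0.ne']
        simp
      · have hr := hrec (k + 1) (by omega) hpos
        rw [Nat.add_sub_cancel, h2q] at hr
        have hstep := rpow_mul_one_add_le_of_add_mul_rpow_le hpos hC₀ hp0 hp1
          (Real.rpow_le_rpow hpos.le (hanti (Nat.zero_le _)) hp0.le)
          (show Ψ (k + 1) + C₀ * Ψ (k + 1) ^ (1 + p) ≤ Ψ k by linarith)
        rw [← hc] at hstep
        have hw : 0 ≤ Ψ k ^ p := Real.rpow_nonneg (hΨ k) p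
        have hd : 0 < 1 + c * Ψ k ^ p := by positivity
        push_cast
        refine le_of_mul_le_mul_right ?_ hd
        have hck : 0 ≤ c * ((k : ℝ) + 1) := by positivity
        nlinarith [mul_le_mul_of_nonneg_left hstep hck]
  refine ⟨c ^ (-(1 / p)), Real.rpow_pos_of_pos hc0 _, fun k hk => ?_⟩
  have hk0 : (0 : ℝ) < k := by exact_mod_cast hk
  have hck : 0 < c * (k : ℝ) := by positivity
  rw [← hp, ← Real.mul_rpow hc0.le hk0.le, Real.rpow_neg hck.le, ← Real.inv_rpow hck.le, one_div,
    Real.le_rpow_inv_iff_of_pos (hΨ k) (inv_nonneg.2 hck.le) hp0, ← one_div, le_div_iff₀ hck]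
  exact key k
end

section
/- Let (a_k) be a sequence of nonnegative reals, (b_k) a sequence of reals, and r ∈ (0,1). Assume that a_{k+1} ≤ r · a_k + b_k − b_{k+1} for every k. Then for all natural numbers k and l: Σ_{j=k}^{k+l} a_{j+1} ≤ (r/(1−r)) · a_k + (1/(1−r)) · (b_k − b_{k+l+1}). -/
/-- Telescoped form of the recursion `a_{k+1} ≤ r a_k + b_k − b_{k+1}`, valid for every real `r`. -/
theorem one_sub_mul_sum_Icc_le (a b : ℕ → ℝ) (r : ℝ)
    (hrec : ∀ k : ℕ, a (k + 1) ≤ r * a k + b k - b (k + 1)) (k l : ℕ) :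
    (1 - r) * ∑ j ∈ Finset.Icc k (k + l), a (j + 1) ≤
      r * (a k - a (k + l + 1)) + (b k - b (k + l + 1)) := by
  induction l with
  | zero =>
    simp only [add_zero, Finset.Icc_self, Finset.sum_singleton]
    linarith [hrec k]
  | succ l ih =>
    rw [← add_assoc, Finset.sum_Icc_succ_top (by omega), mul_add]
    linarith [hrec (k + l + 1)]

/-- Telescoping summation estimate: if `a_{k+1} ≤ r a_k + b_k − b_{k+1}` with `r ∈ (0,1)`
and `a_k ≥ 0`, then `Σ_{j=k}^{k+l} a_{j+1} ≤ (r/(1−r)) a_k + (1/(1−r))(b_k − b_{k+l+1})`. -/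
theorem stmt_9 (a : ℕ → ℝ) (ha : ∀ k, 0 ≤ a k) (b : ℕ → ℝ)
    (r : ℝ) (hr0 : 0 < r) (hr1 : r < 1)
    (hrec : ∀ k : ℕ, a (k + 1) ≤ r * a k + b k - b (k + 1)) :
    ∀ k l : ℕ,
      ∑ j ∈ Finset.Icc k (k + l), a (j + 1) ≤
        (r / (1 - r)) * a k + (1 / (1 - r)) * (b k - b (k + l + 1)) := by
  intro k l
  have hr : 0 < 1 - r := sub_pos.mpr hr1
  have h := one_sub_mul_sum_Icc_le a b r hrec k l
  have hnonneg : 0 ≤ r * a (k + l + 1) := mul_nonneg hr0.le (ha _)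
  calc
    ∑ j ∈ Finset.Icc k (k + l), a (j + 1)
      ≤ (r * a k + (b k - b (k + l + 1))) / (1 - r) := by
        rw [le_div_iff₀' hr]
        linarith
    _ = (r / (1 - r)) * a k + (1 / (1 - r)) * (b k - b (k + l + 1)) := by ring
end

section
/- Let (z_k) be a sequence in ℝ^d and (Ψ_k) a nonincreasing sequence of strictly positive reals with Ψ_k → 0. Let q ∈ (0, 1/2), r ∈ (0,1), ϑ > 0, M > 0, and r₊ > 0, and assume for all k ≥ 1: (a) ‖z_{k+1} − z_k‖² ≤ ϑ · ‖z_k − z_{k−1}‖ · M · (Ψ_k^{1−q} − Ψ_{k+1}^{1−q}); (b) ‖z_k − z_{k−1}‖² ≤ 2 r₊ · Ψ_{k−1}. Then the series Σ_{k≥1} ‖z_{k+1} − z_k‖ converges, hence (z_k) converges to some z* ∈ ℝ^d, and there exists a constant C > 0 such that ‖z_k − z*‖ ≤ C · Ψ_{k−1}^{1/2} for all k ≥ 1. -/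
open Filter

/-- If consecutive distances are dominated by the decrements of a nonnegative potential `W`, then
the distances are summable and `W k` bounds the distance from the `k`-th term to the limit. -/
theorem exists_limit_of_dist_le_potential_sub {E : Type*} [MetricSpace E] [CompleteSpace E]
    {z : ℕ → E} {W : ℕ → ℝ} (hW : ∀ k, 0 ≤ W k)
    (h : ∀ k, dist (z k) (z (k + 1)) ≤ W k - W (k + 1)) :
    Summable (fun k => dist (z k) (z (k + 1))) ∧
      ∃ l, Tendsto z atTop (nhds l) ∧ ∀ k, dist (z k) l ≤ W k := by
  have hsum : Summable (fun k => dist (z k) (z (k + 1))) := by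
    refine summable_of_sum_range_le (c := W 0) (fun _ => dist_nonneg) fun n => ?_
    calc ∑ i ∈ Finset.range n, dist (z i) (z (i + 1))
        ≤ ∑ i ∈ Finset.range n, (W i - W (i + 1)) := Finset.sum_le_sum fun i _ => h i
      _ = W 0 - W n := Finset.sum_range_sub' W n
      _ ≤ W 0 := by linarith [hW n]
  obtain ⟨l, hl⟩ := cauchySeq_tendsto_of_complete (cauchySeq_of_summable_dist hsum)
  refine ⟨hsum, l, hl, fun k => ?_⟩
  have key : ∀ n, k ≤ n → dist (z k) (z n) ≤ W k - W n := by
    intro n hn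
    induction n, hn using Nat.le_induction with
    | base => simp
    | succ n _ ih => linarith [dist_triangle (z k) (z n) (z (n + 1)), h n]
  refine le_of_tendsto (tendsto_const_nhds.dist hl) ?_
  filter_upwards [eventually_ge_atTop k] with n hn
  linarith [key n hn, hW n]

/-- Convergence of the iterates with a value-gap bound on the distance to the limit:
under (a) `‖z_{k+1} − z_k‖² ≤ ϑ ‖z_k − z_{k−1}‖ M (Ψ_k^{1−q} − Ψ_{k+1}^{1−q})` and
(b) `‖z_k − z_{k−1}‖² ≤ 2 r₊ Ψ_{k−1}`, the series `Σ ‖z_{k+1} − z_k‖` converges,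
`z_k → z*`, and `‖z_k − z*‖ ≤ C Ψ_{k−1}^{1/2}`. -/
theorem stmt_10 (d : ℕ) (z : ℕ → EuclideanSpace ℝ (Fin d))
    (Ψ : ℕ → ℝ) (hΨpos : ∀ k, 0 < Ψ k) (hΨdec : ∀ k, Ψ (k + 1) ≤ Ψ k)
    (hΨlim : Tendsto Ψ atTop (nhds 0))
    (q r ϑ M rplus : ℝ)
    (hq0 : 0 < q) (hq1 : q < 1 / 2) (hr0 : 0 < r) (hr1 : r < 1)
    (hϑ : 0 < ϑ) (hM : 0 < M) (hrplus : 0 < rplus)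
    (ha : ∀ k : ℕ, 1 ≤ k →
      ‖z (k + 1) - z k‖ ^ 2 ≤
        ϑ * ‖z k - z (k - 1)‖ * M * ((Ψ k) ^ (1 - q) - (Ψ (k + 1)) ^ (1 - q)))
    (hb : ∀ k : ℕ, 1 ≤ k → ‖z k - z (k - 1)‖ ^ 2 ≤ 2 * rplus * Ψ (k - 1)) :
    Summable (fun k : ℕ => ‖z (k + 1) - z k‖) ∧
      ∃ zstar : EuclideanSpace ℝ (Fin d),
        Tendsto z atTop (nhds zstar) ∧
          ∃ C : ℝ, 0 < C ∧ ∀ k : ℕ, 1 ≤ k →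
            ‖z k - zstar‖ ≤ C * (Ψ (k - 1)) ^ ((1 : ℝ) / 2) := by
  have hK : 0 < ϑ * M := mul_pos hϑ hM
  have hanti : Antitone Ψ := antitone_nat_of_succ_le hΨdec
  have hstep : ∀ k, 2 * ‖z (k + 2) - z (k + 1)‖ ≤ ‖z (k + 1) - z k‖ +
      ϑ * M * (Ψ (k + 1) ^ (1 - q) - Ψ (k + 2) ^ (1 - q)) := by
    intro k
    have h := ha (k + 1) (by omega)
    simp only [Nat.add_sub_cancel] at h
    have hP : Ψ (k + 2) ^ (1 - q) ≤ Ψ (k + 1) ^ (1 - q) :=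
      Real.rpow_le_rpow (hΨpos _).le (hΨdec _) (by linarith)
    have hD := mul_nonneg hK.le (sub_nonneg.2 hP)
    refine abs_le_of_sq_le_sq' ?_ (add_nonneg (norm_nonneg _) hD) |>.2
    nlinarith [sq_nonneg (‖z (k + 1) - z k‖ -
      ϑ * M * (Ψ (k + 1) ^ (1 - q) - Ψ (k + 2) ^ (1 - q)))]
  let W : ℕ → ℝ := fun k => 2 * ‖z (k + 1) - z k‖ + ϑ * M * Ψ (k + 1) ^ (1 - q)
  have hW : ∀ k, 0 ≤ W k := fun k => by
    have := Real.rpow_nonneg (hΨpos (k + 1)).le (1 - q)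
    positivity
  have hdec : ∀ k, dist (z k) (z (k + 1)) ≤ W k - W (k + 1) := by
    intro k
    rw [dist_comm, dist_eq_norm]
    simp only [W]
    linarith [hstep k]
  obtain ⟨hsum, l, hl, hbound⟩ := exists_limit_of_dist_le_potential_sub hW hdec
  refine ⟨hsum.congr fun k => by rw [dist_comm, dist_eq_norm], l, hl,
    2 * √(2 * rplus) + ϑ * M * Ψ 0 ^ (1 / 2 - q), ?_, ?_⟩
  · have := Real.rpow_pos_of_pos (hΨpos 0) (1 / 2 - q)
    positivity
  · intro k hk
    obtain ⟨j, rfl⟩ : ∃ j, k = j + 1 := ⟨k - 1, by omega⟩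
    have hbj := hb (j + 1) hk
    simp only [Nat.add_sub_cancel] at hbj ⊢
    have hgap : ‖z (j + 1) - z j‖ ≤ √(2 * rplus) * Ψ j ^ ((1 : ℝ) / 2) := by
      rw [← Real.sqrt_eq_rpow, ← Real.sqrt_mul (by positivity)]
      exact Real.le_sqrt_of_sq_le hbj
    have hpow : Ψ (j + 1) ^ (1 - q) ≤ Ψ 0 ^ (1 / 2 - q) * Ψ j ^ ((1 : ℝ) / 2) :=
      calc Ψ (j + 1) ^ (1 - q) ≤ Ψ j ^ (1 - q) :=
            Real.rpow_le_rpow (hΨpos _).le (hΨdec _) (by linarith)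
        _ = Ψ j ^ (1 / 2 - q) * Ψ j ^ ((1 : ℝ) / 2) := by
            rw [← Real.rpow_add (hΨpos j)]
            ring_nf
        _ ≤ Ψ 0 ^ (1 / 2 - q) * Ψ j ^ ((1 : ℝ) / 2) :=
            mul_le_mul_of_nonneg_right
              (Real.rpow_le_rpow (hΨpos j).le (hanti (Nat.zero_le j)) (by linarith))
              (Real.rpow_nonneg (hΨpos j).le _)
    have hWj : W (j + 1) ≤ W j := by linarith [hdec j, dist_nonneg (x := z j) (y := z (j + 1))]
    calc ‖z (j + 1) - l‖ = dist (z (j + 1)) l := (dist_eq_norm _ _).symm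
      _ ≤ W j := (hbound _).trans hWj
      _ ≤ _ := by
        simp only [W]
        linarith [mul_le_mul_of_nonneg_left hpow hK.le]
end

section
/- Let f : ℝ^n → ℝ be a differentiable function satisfying the exponent PLK condition at a point x̄ ∈ ℝ^n with exponent α ∈ [1/2, 1), and let β > 0. Define the proximally perturbed function F : ℝ^n × ℝ^n → ℝ by F(x, y) := f(x) + (β/2)‖x − y‖². Then F satisfies the exponent PLK condition at (x̄, x̄) with the same exponent α. -/
/-- A differentiable function `h` satisfies the exponent PLK condition at `x̄` with
exponent `q` if `‖∇h(x)‖ ≥ c (h(x) − h(x̄))^q` for some `c > 0` on a punctured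
sublevel neighborhood of `x̄`. -/
def HasPLKExponent {E : Type*} [NormedAddCommGroup E] [InnerProductSpace ℝ E]
    [CompleteSpace E] (h : E → ℝ) (xbar : E) (q : ℝ) : Prop :=
  ∃ c > 0, ∃ η > 0, ∃ δ > 0, ∀ x : E, ‖x - xbar‖ < δ →
    h xbar < h x → h x < h xbar + η → ‖gradient h x‖ ≥ c * (h x - h xbar) ^ q

section ProximalPerturbation

variable {E : Type*} [NormedAddCommGroup E] [InnerProductSpace ℝ E] [CompleteSpace E]

/-- The gradient of `(x, y) ↦ f x + (β / 2) * ‖x - y‖ ^ 2` on the `L²` product. -/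
theorem hasGradientAt_add_mul_norm_sub_sq {f : E → ℝ} (β : ℝ) (p : WithLp 2 (E × E))
    (hf : DifferentiableAt ℝ f p.fst) :
    HasGradientAt (fun p : WithLp 2 (E × E) => f p.fst + (β / 2) * ‖p.fst - p.snd‖ ^ 2)
      (WithLp.toLp 2 (gradient f p.fst + β • (p.fst - p.snd), -(β • (p.fst - p.snd)))) p := by
  rw [hasGradientAt_iff_hasFDerivAt]
  have hfst : HasFDerivAt (fun p : WithLp 2 (E × E) => p.fst) (WithLp.fstL 2 ℝ E E) p :=
    (WithLp.fstL 2 ℝ E E).hasFDerivAt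
  have hsnd : HasFDerivAt (fun p : WithLp 2 (E × E) => p.snd) (WithLp.sndL 2 ℝ E E) p :=
    (WithLp.sndL 2 ℝ E E).hasFDerivAt
  have hcomp := (hasGradientAt_iff_hasFDerivAt.mp hf.hasGradientAt).comp p hfst
  refine (hcomp.add ((hfst.sub hsnd).norm_sq.const_mul (β / 2))).congr_fderiv ?_
  ext v
  simp [WithLp.prod_inner_apply, inner_add_left, inner_sub_left, inner_smul_left]
  ring

/-- For exponents `α ∈ [1/2, 1]`, a bound of order `α` in `a` and a square-root bound in `t ≤ 1`
combine to a bound of order `α` in `a + t`. -/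
theorem min_mul_add_rpow_le {a t c d α : ℝ} (ha : 0 ≤ a) (ht0 : 0 ≤ t) (ht1 : t ≤ 1)
    (hα0 : 1 / 2 ≤ α) (hα1 : α ≤ 1) (hc : 0 ≤ c) (hd : 0 ≤ d) :
    min c d * (a + t) ^ α ≤ c * a ^ α + d * √t := by
  have hsub : (a + t) ^ α ≤ a ^ α + t ^ α :=
    NNReal.coe_le_coe.2 (NNReal.rpow_add_le_add_rpow ⟨a, ha⟩ ⟨t, ht0⟩ (by linarith) hα1)
  have hsqrt : t ^ α ≤ √t := by
    rw [Real.sqrt_eq_rpow]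
    exact Real.rpow_le_rpow_of_exponent_ge' ht0 ht1 (by norm_num) hα0
  have hm : 0 ≤ min c d := le_min hc hd
  calc min c d * (a + t) ^ α ≤ min c d * (a ^ α + t ^ α) := by gcongr
    _ = min c d * a ^ α + min c d * t ^ α := by ring
    _ ≤ c * a ^ α + d * √t := by
      gcongr
      · exact min_le_left _ _
      · exact min_le_right _ _

/-- The PLK exponent `α ∈ [1/2, 1)` is preserved by the proximal perturbation. -/
theorem HasPLKExponent.proximal_perturbation {f : E → ℝ} (hf : Differentiable ℝ f) {xbar : E}
    {α : ℝ} (hα0 : 1 / 2 ≤ α) (hα1 : α < 1) (h : HasPLKExponent f xbar α) {β : ℝ}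
    (hβ : 0 < β) :
    HasPLKExponent (fun p : WithLp 2 (E × E) => f p.fst + (β / 2) * ‖p.fst - p.snd‖ ^ 2)
      (WithLp.toLp 2 (xbar, xbar)) α := by
  obtain ⟨c, hc, η, hη, δ, hδ, h⟩ := h
  have hm : 0 < min c √(2 * β) := lt_min hc (by positivity)
  refine ⟨min c √(2 * β) / 3, by positivity, min η 1, by positivity, δ, hδ, ?_⟩
  intro p hp hlt hub
  rw [(hasGradientAt_add_mul_norm_sub_sq β p (hf _)).gradient]
  have hbar : f (WithLp.toLp 2 (xbar, xbar)).fst + β / 2 *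
      ‖(WithLp.toLp 2 (xbar, xbar)).fst - (WithLp.toLp 2 (xbar, xbar)).snd‖ ^ 2 = f xbar := by
    simp
  simp only [hbar] at hlt hub ⊢
  have hx : ‖p.fst - xbar‖ < δ :=
    (WithLp.norm_fst_le _ (p - WithLp.toLp 2 (xbar, xbar))).trans_lt hp
  set u := p.fst - p.snd
  set g := gradient f p.fst
  set G : WithLp 2 (E × E) := WithLp.toLp 2 (g + β • u, -(β • u))
  have hnorm : ‖β • u‖ = β * ‖u‖ := by rw [norm_smul, Real.norm_of_nonneg hβ.le]
  have hG1 : ‖g + β • u‖ ≤ ‖G‖ := WithLp.norm_fst_le _ G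
  have hG2 : β * ‖u‖ ≤ ‖G‖ := by
    rw [← hnorm, ← norm_neg]
    exact WithLp.norm_snd_le _ G
  have hg : ‖g‖ ≤ ‖g + β • u‖ + β * ‖u‖ := by
    rw [← hnorm]
    simpa using norm_sub_le (g + β • u) (β • u)
  have hη' := min_le_left η 1
  have hone := min_le_right η 1
  have ht0 : 0 ≤ β / 2 * ‖u‖ ^ 2 := by positivity
  have hsqrt : √(2 * β) * √(β / 2 * ‖u‖ ^ 2) = β * ‖u‖ := by
    rw [← Real.sqrt_mul (by positivity),
      show 2 * β * (β / 2 * ‖u‖ ^ 2) = (β * ‖u‖) ^ 2 by ring, Real.sqrt_sq (by positivity)]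
  suffices hmain : min c √(2 * β) * (f p.fst + β / 2 * ‖u‖ ^ 2 - f xbar) ^ α ≤
      ‖g‖ + β * ‖u‖ by
    linarith
  rcases lt_or_ge (f xbar) (f p.fst) with hpos | hneg
  · have hgrad := h p.fst hx hpos (by linarith)
    have key := min_mul_add_rpow_le (sub_nonneg.2 hpos.le) ht0 (by linarith) hα0 hα1.le hc.le
      (Real.sqrt_nonneg (2 * β))
    rw [show f p.fst + β / 2 * ‖u‖ ^ 2 - f xbar = f p.fst - f xbar + β / 2 * ‖u‖ ^ 2 by ring]
    linarith
  · have key := min_mul_add_rpow_le (t := f p.fst + β / 2 * ‖u‖ ^ 2 - f xbar) le_rfl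
      (by linarith) (by linarith) hα0 hα1.le hc.le (Real.sqrt_nonneg (2 * β))
    rw [zero_add, Real.zero_rpow (by linarith), mul_zero, zero_add] at key
    have hle : √(f p.fst + β / 2 * ‖u‖ ^ 2 - f xbar) ≤ √(β / 2 * ‖u‖ ^ 2) :=
      Real.sqrt_le_sqrt (by linarith)
    have := mul_le_mul_of_nonneg_left hle (Real.sqrt_nonneg (2 * β))
    linarith [norm_nonneg g]

end ProximalPerturbation

/-- PLK exponent calculus for the proximally perturbed function: if `f` satisfies the
exponent PLK condition at `x̄` with exponent `α ∈ [1/2, 1)` and `β > 0`, then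
`F(x, y) = f(x) + (β/2)‖x − y‖²` satisfies it at `(x̄, x̄)` with the same exponent `α`.
The product `ℝ^n × ℝ^n` carries the Euclidean (`L²`) norm, encoded via `WithLp 2`. -/
theorem stmt_12 (n : ℕ) (f : EuclideanSpace ℝ (Fin n) → ℝ)
    (hf : Differentiable ℝ f)
    (xbar : EuclideanSpace ℝ (Fin n)) (α : ℝ) (hα0 : 1 / 2 ≤ α) (hα1 : α < 1)
    (hPLK : HasPLKExponent f xbar α) (β : ℝ) (hβ : 0 < β) :
    HasPLKExponent
      (fun p : WithLp 2 (EuclideanSpace ℝ (Fin n) × EuclideanSpace ℝ (Fin n)) =>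
        f (WithLp.equiv 2 _ p).1 +
          (β / 2) * ‖(WithLp.equiv 2 _ p).1 - (WithLp.equiv 2 _ p).2‖ ^ 2)
      ((WithLp.equiv 2 (EuclideanSpace ℝ (Fin n) × EuclideanSpace ℝ (Fin n))).symm
        (xbar, xbar))
      α := by
  exact hPLK.proximal_perturbation hf hα0 hα1 hβ
end

section
/- For every real number x, the inequality | (3/2)·sign(x)·|x|^{1/2} + 2x |³ ≥ |x|^{3/2} + x² holds, where sign(x) equals 1 for x > 0, −1 for x < 0, and 0 for x = 0. Consequently, the function L(x) = |x|^{3/2} + x², whose derivative is L′(x) = (3/2)·sign(x)·|x|^{1/2} + 2x, satisfies the lower exponent PLK inequality |L′(x)| ≥ (1/5)·(|x|^{3/2} + x²)^{1/3} for all x ∈ ℝ. -/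
theorem abs_sign_mul_sqrt_add (x : ℝ) :
    |(3 / 2) * Real.sign x * |x| ^ ((1 : ℝ) / 2) + 2 * x| = 3 / 2 * √|x| + 2 * √|x| ^ 2 := by
  rw [← Real.sqrt_eq_rpow, Real.sq_sqrt (abs_nonneg x)]
  rcases lt_trichotomy x 0 with hx | rfl | hx
  · have hs := Real.sqrt_nonneg |x|
    rw [Real.sign_of_neg hx, abs_of_nonpos (by linarith), abs_of_neg hx]
    ring
  · simp
  · have hs := Real.sqrt_nonneg |x|
    rw [Real.sign_of_pos hx, abs_of_nonneg (by linarith), abs_of_pos hx]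
    ring

theorem abs_rpow_three_halves_add_sq (x : ℝ) :
    |x| ^ ((3 : ℝ) / 2) + x ^ 2 = √|x| ^ 3 + √|x| ^ 4 := by
  have h3 : |x| ^ ((3 : ℝ) / 2) = √|x| ^ 3 := by
    rw [Real.sqrt_eq_rpow, ← Real.rpow_mul_natCast (abs_nonneg x)]
    norm_num
  have h4 : √|x| ^ 4 = x ^ 2 := by
    rw [← sq_abs x, show √|x| ^ 4 = (√|x| ^ 2) ^ 2 by ring, Real.sq_sqrt (abs_nonneg x)]
  rw [h3, h4]

theorem cube_add_pow_four_le {t : ℝ} (ht : 0 ≤ t) :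
    t ^ 3 + t ^ 4 ≤ (3 / 2 * t + 2 * t ^ 2) ^ 3 := by
  have h : 0 ≤ 19 / 8 * t ^ 3 + 25 / 2 * t ^ 4 + 18 * t ^ 5 + 8 * t ^ 6 := by positivity
  linarith


/-- Example 1: for all `x ∈ ℝ`, `|(3/2) sign(x) |x|^{1/2} + 2x|³ ≥ |x|^{3/2} + x²`;
consequently the function `L(x) = |x|^{3/2} + x²`, with derivative
`L′(x) = (3/2) sign(x) |x|^{1/2} + 2x`, satisfies the lower exponent PLK inequality
`|L′(x)| ≥ (1/5)(|x|^{3/2} + x²)^{1/3}`. -/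
theorem stmt_13 :
    (∀ x : ℝ,
      |(3 / 2) * Real.sign x * |x| ^ ((1 : ℝ) / 2) + 2 * x| ^ (3 : ℕ) ≥
        |x| ^ ((3 : ℝ) / 2) + x ^ 2) ∧
    (∀ x : ℝ,
      |(3 / 2) * Real.sign x * |x| ^ ((1 : ℝ) / 2) + 2 * x| ≥
        (1 / 5) * (|x| ^ ((3 : ℝ) / 2) + x ^ 2) ^ ((1 : ℝ) / 3)) := by
  have cube_le (x : ℝ) : |x| ^ ((3 : ℝ) / 2) + x ^ 2 ≤
      |(3 / 2) * Real.sign x * |x| ^ ((1 : ℝ) / 2) + 2 * x| ^ (3 : ℕ) := by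
    rw [abs_sign_mul_sqrt_add, abs_rpow_three_halves_add_sq]
    exact cube_add_pow_four_le (Real.sqrt_nonneg _)
  refine ⟨cube_le, fun x => ?_⟩
  have hL : 0 ≤ |x| ^ ((3 : ℝ) / 2) + x ^ 2 := by positivity
  have hroot : (|x| ^ ((3 : ℝ) / 2) + x ^ 2) ^ ((1 : ℝ) / 3) ≤
      |(3 / 2) * Real.sign x * |x| ^ ((1 : ℝ) / 2) + 2 * x| := by
    refine (Real.rpow_le_rpow hL (cube_le x) (by norm_num)).trans_eq ?_
    rw [← Real.rpow_natCast_mul (abs_nonneg _)]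
    norm_num
  have hnonneg := Real.rpow_nonneg hL ((1 : ℝ) / 3)
  linarith
end

section
/- Let f : ℝ² → ℝ be defined by f(x, y) = |x|^{3/2} + y², which is differentiable with ∇f(x, y) = ((3/2)·sign(x)·|x|^{1/2}, 2y). Then for every q ∈ [0, 1/2), every M > 0, and every δ > 0, there exists a point (x, y) with ‖(x, y)‖ < δ and f(x, y) > f(0,0) = 0 such that ‖∇f(x, y)‖ < M · (f(x, y))^q. In other words, f fails the exponent PLK condition at (0,0) for every exponent q < 1/2. -/
/-- Example 2 (failure part): the function `f(x, y) = |x|^{3/2} + y²`, whose gradient is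
`((3/2) sign(x) |x|^{1/2}, 2y)`, fails the exponent PLK condition at `(0,0)` for every
exponent `q ∈ [0, 1/2)`: arbitrarily close to the origin there are points where
`‖∇f(x,y)‖ < M (f(x,y))^q` while `f(x,y) > 0`. The Euclidean norm on `ℝ²` is written
explicitly via `Real.sqrt`. -/
theorem stmt_14 :
    ∀ q : ℝ, 0 ≤ q → q < 1 / 2 → ∀ M : ℝ, 0 < M → ∀ δ : ℝ, 0 < δ →
      ∃ x y : ℝ, Real.sqrt (x ^ 2 + y ^ 2) < δ ∧
        0 < |x| ^ ((3 : ℝ) / 2) + y ^ 2 ∧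
        Real.sqrt (((3 / 2) * Real.sign x * |x| ^ ((1 : ℝ) / 2)) ^ 2 + (2 * y) ^ 2) <
          M * (|x| ^ ((3 : ℝ) / 2) + y ^ 2) ^ q := by
  intro q _ hq M hM δ hδ
  have hlim : Filter.Tendsto (fun t : ℝ => 2 * t ^ (1 - 2 * q)) (nhdsWithin 0 (Set.Ioi 0))
      (nhds 0) := by
    have h : ContinuousAt (fun t : ℝ => 2 * t ^ (1 - 2 * q)) 0 :=
      continuousAt_const.mul (Real.continuousAt_rpow_const 0 _ (Or.inr (by linarith)))
    have h0 := h.tendsto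
    rw [Real.zero_rpow (by linarith), mul_zero] at h0
    exact h0.mono_left nhdsWithin_le_nhds
  obtain ⟨t, htM, ht, htδ⟩ :=
    ((hlim.eventually_lt_const hM).and (Ioo_mem_nhdsGT hδ)).exists
  have ht : 0 < t := ht
  refine ⟨0, t, ?_, ?_, ?_⟩
  · rwa [zero_pow two_ne_zero, zero_add, Real.sqrt_sq ht.le]
  · positivity
  · have hf : |(0 : ℝ)| ^ ((3 : ℝ) / 2) + t ^ 2 = t ^ 2 := by
      rw [abs_zero, Real.zero_rpow (by norm_num), zero_add]
    have hg : ((3 / 2) * Real.sign 0 * |(0 : ℝ)| ^ ((1 : ℝ) / 2)) ^ 2 + (2 * t) ^ 2 =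
        (2 * t) ^ 2 := by
      simp
    have hpow : (t ^ 2) ^ q = t ^ (2 * q) := by
      rw [← Real.rpow_natCast, ← Real.rpow_mul ht.le, Nat.cast_ofNat]
    rw [hf, hg, Real.sqrt_sq (by positivity), hpow]
    calc 2 * t = 2 * t ^ (1 - 2 * q) * t ^ (2 * q) := by
          rw [mul_assoc, ← Real.rpow_add ht, sub_add_cancel, Real.rpow_one]
      _ < M * t ^ (2 * q) := mul_lt_mul_of_pos_right htM (Real.rpow_pos_of_pos ht _)
end

section
/- Let L : ℝ² → ℝ be defined by L(x, y) = |x|^{3/2} + |y|^{3/2} + (x − y)², which is continuously differentiable with ∇L(x, y) = ((3/2)·sign(x)·|x|^{1/2} + 2(x − y), (3/2)·sign(y)·|y|^{1/2} − 2(x − y)). Then there exists δ > 0 such that for all (x, y) with ‖(x, y)‖ < δ: ‖∇L(x, y)‖³ ≥ |x|^{3/2} + |y|^{3/2} + (x − y)². Consequently, L satisfies the exponent PLK condition at its critical point (0,0) with lower exponent q = 1/3. -/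
/-- The signed square root of `x`: the unique `a` with `a * |a| = x`. -/
theorem sign_mul_rpow_half_mul_abs (x : ℝ) :
    (Real.sign x * |x| ^ ((1 : ℝ) / 2)) * |Real.sign x * |x| ^ ((1 : ℝ) / 2)| = x := by
  have hp : 0 ≤ |x| ^ ((1 : ℝ) / 2) := by positivity
  have hsq : |x| ^ ((1 : ℝ) / 2) * |x| ^ ((1 : ℝ) / 2) = |x| := by
    rw [← Real.sqrt_eq_rpow, Real.mul_self_sqrt (abs_nonneg x)]
  rcases lt_trichotomy x 0 with h | h | h
  · rw [Real.sign_of_neg h, neg_one_mul, abs_neg, abs_of_nonneg hp, neg_mul, hsq, abs_of_neg h,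
      neg_neg]
  · simp [h]
  · rw [Real.sign_of_pos h, one_mul, abs_of_nonneg hp, hsq, abs_of_pos h]

theorem abs_mul_abs_rpow_three_halves (a : ℝ) : |(a * |a|)| ^ ((3 : ℝ) / 2) = |a| ^ 3 := by
  rw [abs_mul, abs_abs, ← sq, ← Real.rpow_natCast, ← Real.rpow_mul (abs_nonneg a),
    ← Real.rpow_natCast]
  norm_num

theorem sub_mul_abs_mul_sub_nonneg (a b : ℝ) : 0 ≤ (a * |a| - b * |b|) * (a - b) := by
  have ha := abs_nonneg a
  have hb := abs_nonneg b
  have hab : a * b ≤ |a| * |b| := (le_abs_self _).trans (abs_mul a b).le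
  have key : (a * |a| - b * |b|) * (a - b) =
      (|a| + |b|) * (|a| * |b| - a * b) + (|a| + |b|) * (|a| - |b|) ^ 2 := by
    linear_combination (-|a|) * sq_abs a - |b| * sq_abs b
  rw [key]
  have := sub_nonneg.2 hab
  positivity

/-- The gradient inequality in terms of the signed square roots `a`, `b` of the coordinates. -/
theorem le_sqrt_gradient_pow_three {a b : ℝ} (h : a ^ 2 + b ^ 2 ≤ 1) :
    |a| ^ 3 + |b| ^ 3 + (a * |a| - b * |b|) ^ 2 ≤
      √((3 / 2 * a + 2 * (a * |a| - b * |b|)) ^ 2 +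
        (3 / 2 * b - 2 * (a * |a| - b * |b|)) ^ 2) ^ 3 := by
  set d := a * |a| - b * |b| with hd
  set r := √(a ^ 2 + b ^ 2) with hr
  have hr0 : 0 ≤ r := Real.sqrt_nonneg _
  have hr2 : r ^ 2 = a ^ 2 + b ^ 2 := Real.sq_sqrt (by positivity)
  have hr1 : r ≤ 1 := Real.sqrt_le_one.2 h
  have hmono : 0 ≤ d * (a - b) := sub_mul_abs_mul_sub_nonneg a b
  have hgrad : 3 / 2 * r ≤ √((3 / 2 * a + 2 * d) ^ 2 + (3 / 2 * b - 2 * d) ^ 2) := by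
    apply Real.le_sqrt_of_sq_le
    nlinarith [sq_nonneg d]
  have har : |a| ≤ r := Real.abs_le_sqrt (by nlinarith [sq_nonneg b])
  have hbr : |b| ≤ r := Real.abs_le_sqrt (by nlinarith [sq_nonneg a])
  have hd2 : |d| ≤ r ^ 2 := by
    calc |d| ≤ |(a * |a|)| + |(b * |b|)| := abs_sub _ _
      _ = r ^ 2 := by simp only [abs_mul, abs_abs, abs_mul_abs_self, hr2, sq]
  have hd4 : d ^ 2 ≤ r ^ 3 := by
    calc d ^ 2 = |d| ^ 2 := (sq_abs d).symm
      _ ≤ (r ^ 2) ^ 2 := by gcongr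
      _ = r ^ 3 * r := by ring
      _ ≤ r ^ 3 := mul_le_of_le_one_right (by positivity) hr1
  have ha3 : |a| ^ 3 + |b| ^ 3 ≤ r ^ 3 := by
    calc |a| ^ 3 + |b| ^ 3 = |a| * a ^ 2 + |b| * b ^ 2 := by rw [← sq_abs a, ← sq_abs b]; ring
      _ ≤ r * a ^ 2 + r * b ^ 2 := by gcongr
      _ = r ^ 3 := by rw [← mul_add, ← hr2]; ring
  calc |a| ^ 3 + |b| ^ 3 + d ^ 2 ≤ (3 / 2 * r) ^ 3 := by nlinarith [pow_nonneg hr0 3]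
    _ ≤ _ := by gcongr


/-- Example 4: for `L(x, y) = |x|^{3/2} + |y|^{3/2} + (x − y)²`, with gradient
`((3/2) sign(x) |x|^{1/2} + 2(x − y), (3/2) sign(y) |y|^{1/2} − 2(x − y))`, there is a
neighborhood of the origin on which `‖∇L(x,y)‖³ ≥ L(x,y)`; consequently `L` satisfies the
exponent PLK condition at its critical point `(0,0)` with lower exponent `q = 1/3`.
The Euclidean norm on `ℝ²` is written explicitly via `Real.sqrt`. -/
theorem stmt_17 :
    (∃ δ : ℝ, 0 < δ ∧ ∀ x y : ℝ, Real.sqrt (x ^ 2 + y ^ 2) < δ →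
      (Real.sqrt (((3 / 2) * Real.sign x * |x| ^ ((1 : ℝ) / 2) + 2 * (x - y)) ^ 2 +
          ((3 / 2) * Real.sign y * |y| ^ ((1 : ℝ) / 2) - 2 * (x - y)) ^ 2)) ^ (3 : ℕ) ≥
        |x| ^ ((3 : ℝ) / 2) + |y| ^ ((3 : ℝ) / 2) + (x - y) ^ 2) ∧
    (∃ c : ℝ, 0 < c ∧ ∃ δ : ℝ, 0 < δ ∧ ∀ x y : ℝ, Real.sqrt (x ^ 2 + y ^ 2) < δ →
      Real.sqrt (((3 / 2) * Real.sign x * |x| ^ ((1 : ℝ) / 2) + 2 * (x - y)) ^ 2 +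
          ((3 / 2) * Real.sign y * |y| ^ ((1 : ℝ) / 2) - 2 * (x - y)) ^ 2) ≥
        c * (|x| ^ ((3 : ℝ) / 2) + |y| ^ ((3 : ℝ) / 2) + (x - y) ^ 2) ^ ((1 : ℝ) / 3)) := by
  have key : ∀ x y : ℝ, Real.sqrt (x ^ 2 + y ^ 2) < 1 / 2 →
      (Real.sqrt (((3 / 2) * Real.sign x * |x| ^ ((1 : ℝ) / 2) + 2 * (x - y)) ^ 2 +
          ((3 / 2) * Real.sign y * |y| ^ ((1 : ℝ) / 2) - 2 * (x - y)) ^ 2)) ^ (3 : ℕ) ≥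
        |x| ^ ((3 : ℝ) / 2) + |y| ^ ((3 : ℝ) / 2) + (x - y) ^ 2 := by
    intro x y hxy
    have hx : |x| < 1 / 2 := (Real.abs_le_sqrt (by nlinarith [sq_nonneg y])).trans_lt hxy
    have hy : |y| < 1 / 2 := (Real.abs_le_sqrt (by nlinarith [sq_nonneg x])).trans_lt hxy
    rw [mul_assoc, mul_assoc]
    have hxa := sign_mul_rpow_half_mul_abs x
    have hyb := sign_mul_rpow_half_mul_abs y
    generalize Real.sign x * |x| ^ ((1 : ℝ) / 2) = a at *
    generalize Real.sign y * |y| ^ ((1 : ℝ) / 2) = b at *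
    subst hxa hyb
    rw [abs_mul_abs_rpow_three_halves, abs_mul_abs_rpow_three_halves]
    apply le_sqrt_gradient_pow_three
    rw [abs_mul, abs_abs, abs_mul_abs_self] at hx hy
    linarith
  refine ⟨⟨1 / 2, by norm_num, key⟩, 1, one_pos, 1 / 2, by norm_num, fun x y hxy => ?_⟩
  rw [one_mul, ge_iff_le, one_div, Real.rpow_inv_le_iff_of_pos (by positivity) (by positivity)
    (by norm_num)]
  exact_mod_cast key x y hxy
end
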